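/- Let A be the presented group with generators a, b, c and relations ab = ba, bcb = cbc, and aca = cac. Then there is no group homomorphism ρ : A → A with ρ(a) = a, ρ(b) = b, and ρ(c) lying in the subgroup generated by a and b; that is, A admits no retraction onto the standard parabolic subgroup generated by a and b. -/

import Mathlib

/-- Relations of the Artin group of the triangle `(2,3,3)` on generators
`a = 0`, `b = 1`, `c = 2`: `ab = ba`, `bcb = cbc`, `aca = cac`. -/
def triangleRels : Set (FreeGroup (Fin 3)) :=
  { FreeGroup.of 0 * FreeGroup.of 1 * (FreeGroup.of 1 * FreeGroup.of 0)⁻¹,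
    FreeGroup.of 1 * FreeGroup.of 2 * FreeGroup.of 1 *
      (FreeGroup.of 2 * FreeGroup.of 1 * FreeGroup.of 2)⁻¹,
    FreeGroup.of 0 * FreeGroup.of 2 * FreeGroup.of 0 *
      (FreeGroup.of 2 * FreeGroup.of 0 * FreeGroup.of 2)⁻¹ }

/-- Two commuting elements satisfying the braid relation are equal. -/
theorem Commute.eq_of_braid {G : Type*} [Group G] {x y : G} (h : Commute x y)
    (hb : x * y * x = y * x * y) : x = y := by
  rw [h.eq] at hb
  exact mul_left_cancel hb

namespace PresentedGroup

theorem commute_of_zero_of_one :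
    Commute (of 0 : PresentedGroup triangleRels) (of 1) :=
  mul_inv_eq_one.mp (one_of_mem (rels := triangleRels) (Or.inl rfl))

theorem braid_of_one_of_two :
    (of 1 * of 2 * of 1 : PresentedGroup triangleRels) = of 2 * of 1 * of 2 :=
  mul_inv_eq_one.mp (one_of_mem (rels := triangleRels) (Or.inr (Or.inl rfl)))

theorem braid_of_zero_of_two :
    (of 0 * of 2 * of 0 : PresentedGroup triangleRels) = of 2 * of 0 * of 2 :=
  mul_inv_eq_one.mp (one_of_mem (rels := triangleRels) (Or.inr (Or.inr rfl)))

/-- The generators `a` and `b` are distinct: they are sent to the disjoint transpositions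
`(0 1)` and `(2 3)` by the map to the symmetric group on four letters. -/
theorem of_zero_ne_of_one : (of 0 : PresentedGroup triangleRels) ≠ of 1 := by
  let f : Fin 3 → Equiv.Perm (Fin 4) := ![Equiv.swap 0 1, Equiv.swap 2 3, Equiv.swap 1 2]
  have hf : ∀ r ∈ triangleRels, FreeGroup.lift f r = 1 := by
    rintro r (rfl | rfl | rfl) <;> simp only [map_mul, map_inv, FreeGroup.lift_apply_of] <;> decide
  intro h
  have h' := congrArg (toGroup hf) h
  rw [toGroup.of, toGroup.of] at h'
  exact absurd h' (by decide)

end PresentedGroup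

/-- The Artin group of the triangle `(2,3,3)` admits no retraction onto the standard
parabolic subgroup generated by `a` and `b`. -/
theorem no_retraction_233 :
    ¬ ∃ ρ : PresentedGroup triangleRels →* PresentedGroup triangleRels,
        ρ (PresentedGroup.of 0) = PresentedGroup.of 0 ∧
        ρ (PresentedGroup.of 1) = PresentedGroup.of 1 ∧
        ρ (PresentedGroup.of 2) ∈
          Subgroup.closure {PresentedGroup.of 0, PresentedGroup.of 1} := by
  rintro ⟨ρ, ha, hb, hc⟩
  have hab := PresentedGroup.commute_of_zero_of_one
  have hle : Subgroup.closure {PresentedGroup.of 0, PresentedGroup.of 1} ≤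
      Subgroup.centralizer
        ({PresentedGroup.of 0, PresentedGroup.of 1} : Set (PresentedGroup triangleRels)) := by
    rw [Subgroup.closure_le]
    rintro _ (rfl | rfl) _ (rfl | rfl)
    exacts [rfl, hab.symm.eq, hab.eq, rfl]
  have hcent := hle hc
  have h₀ := congrArg ρ PresentedGroup.braid_of_zero_of_two
  have h₁ := congrArg ρ PresentedGroup.braid_of_one_of_two
  simp only [map_mul, ha, hb] at h₀ h₁
  have e₀ := Commute.eq_of_braid (hcent _ (Or.inl rfl)) h₀
  have e₁ := Commute.eq_of_braid (hcent _ (Or.inr rfl)) h₁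
  exact PresentedGroup.of_zero_ne_of_one (e₀.trans e₁.symm)
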